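/- arXiv:2211.12099 — 2 statements merged into one kernel-verified Lean document; each statement's English description precedes it below -/
import Mathlib

section
/- In the abstract semigroup setting, let φ⁺ ∈ E⁺ and φ⁻ ∈ E⁻ with φ⁻ ≤ φ⁺, and let u ∈ X satisfy φ⁻ ≤ u ≤ φ⁺. Then for every finite composition T = T_n ∘ ⋯ ∘ T_1, where each T_i is of the form S₊(δ_i) or S₋(δ_i) with δ_i ≥ 0, one has φ⁻ ≤ T u ≤ φ⁺. -/
open Filter Topology

instance : Fact ((0 : ℝ) < 1) := ⟨one_pos⟩

/-- The `d`-dimensional torus `𝕋^d = (ℝ/ℤ)^d`. -/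
abbrev Torus (d : ℕ) := Fin d → AddCircle (1 : ℝ)

/-- The abstract semigroup setting: two semigroups `S₊ = Sp`, `S₋ = Sm` on an ordered
normed space `X`, each `S_±(t)` order-preserving and nonexpansive, satisfying the
order inequality `S₋(t)(S₊(t)u) ≤ u ≤ S₊(t)(S₋(t)u)`. -/
structure SGSettingCore {X : Type*} [NormedAddCommGroup X] [PartialOrder X]
    (Sp Sm : ℝ → X → X) : Prop where
  Sp_zero : ∀ u, Sp 0 u = u
  Sm_zero : ∀ u, Sm 0 u = u
  Sp_add : ∀ s t : ℝ, 0 ≤ s → 0 ≤ t → ∀ u, Sp (s + t) u = Sp s (Sp t u)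
  Sm_add : ∀ s t : ℝ, 0 ≤ s → 0 ≤ t → ∀ u, Sm (s + t) u = Sm s (Sm t u)
  Sp_mono : ∀ t : ℝ, 0 ≤ t → ∀ u v, u ≤ v → Sp t u ≤ Sp t v
  Sm_mono : ∀ t : ℝ, 0 ≤ t → ∀ u v, u ≤ v → Sm t u ≤ Sm t v
  Sp_nonexp : ∀ t : ℝ, 0 ≤ t → ∀ u v, ‖Sp t u - Sp t v‖ ≤ ‖u - v‖
  Sm_nonexp : ∀ t : ℝ, 0 ≤ t → ∀ u v, ‖Sm t u - Sm t v‖ ≤ ‖u - v‖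
  order_le : ∀ t : ℝ, 0 ≤ t → ∀ u, Sm t (Sp t u) ≤ u
  order_ge : ∀ t : ℝ, 0 ≤ t → ∀ u, u ≤ Sp t (Sm t u)

/-- `φ ∈ E⁺`: a fixed point of the forward semigroup. -/
def IsFixedPlus {X : Type*} (Sp : ℝ → X → X) (φ : X) : Prop :=
  ∀ t : ℝ, 0 ≤ t → Sp t φ = φ

/-- `φ ∈ E⁻`: a fixed point of the backward semigroup. -/
def IsFixedMinus {X : Type*} (Sm : ℝ → X → X) (φ : X) : Prop :=
  ∀ t : ℝ, 0 ≤ t → Sm t φ = φ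

/-- A finite composition `T = T_n ∘ ⋯ ∘ T_1`, where each `T_i` is of the form
`S₊(δᵢ)` (for `true`) or `S₋(δᵢ)` (for `false`). -/
def applyOps {X : Type*} (Sp Sm : ℝ → X → X) : List (Bool × ℝ) → X → X
  | [], u => u
  | (b, δ) :: rest, u => (if b then Sp δ else Sm δ) (applyOps Sp Sm rest u)

namespace SGSettingCore

variable {X : Type*} [NormedAddCommGroup X] [PartialOrder X] {Sp Sm : ℝ → X → X}

theorem Sm_le_of_isFixedPlus (h : SGSettingCore Sp Sm) {φ : X} (hφ : IsFixedPlus Sp φ)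
    {t : ℝ} (ht : 0 ≤ t) : Sm t φ ≤ φ := by
  simpa only [hφ t ht] using h.order_le t ht φ

theorem le_Sp_of_isFixedMinus (h : SGSettingCore Sp Sm) {φ : X} (hφ : IsFixedMinus Sm φ)
    {t : ℝ} (ht : 0 ≤ t) : φ ≤ Sp t φ := by
  simpa only [hφ t ht] using h.order_ge t ht φ

theorem applyOps_le (h : SGSettingCore Sp Sm) {φ u : X} (hφ : IsFixedPlus Sp φ) (hu : u ≤ φ)
    (L : List (Bool × ℝ)) (hL : ∀ p ∈ L, 0 ≤ p.2) : applyOps Sp Sm L u ≤ φ := by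
  induction L with
  | nil => exact hu
  | cons p L ih =>
    obtain ⟨b, t⟩ := p
    obtain ⟨ht, hrest⟩ := List.forall_mem_cons.1 hL
    cases b
    · exact (h.Sm_mono t ht _ _ (ih hrest)).trans (h.Sm_le_of_isFixedPlus hφ ht)
    · exact (h.Sp_mono t ht _ _ (ih hrest)).trans_eq (hφ t ht)

theorem le_applyOps (h : SGSettingCore Sp Sm) {φ u : X} (hφ : IsFixedMinus Sm φ) (hu : φ ≤ u)
    (L : List (Bool × ℝ)) (hL : ∀ p ∈ L, 0 ≤ p.2) : φ ≤ applyOps Sp Sm L u := by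
  induction L with
  | nil => exact hu
  | cons p L ih =>
    obtain ⟨b, t⟩ := p
    obtain ⟨ht, hrest⟩ := List.forall_mem_cons.1 hL
    cases b
    · exact (hφ t ht).symm.trans_le (h.Sm_mono t ht _ _ (ih hrest))
    · exact (h.le_Sp_of_isFixedMinus hφ ht).trans (h.Sp_mono t ht _ _ (ih hrest))

end SGSettingCore

/-- In the abstract semigroup setting on `X = C(𝕋^d; ℝ)`, let
`φ⁺ ∈ E⁺` and `φ⁻ ∈ E⁻` with `φ⁻ ≤ φ⁺`, and let `u ∈ X` satisfy `φ⁻ ≤ u ≤ φ⁺`.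
Then for every finite composition `T = T_n ∘ ⋯ ∘ T_1`, where each `T_i` is of the form
`S₊(δᵢ)` or `S₋(δᵢ)` with `δᵢ ≥ 0`, one has `φ⁻ ≤ T u ≤ φ⁺`. -/
theorem sandwich_preserved_by_compositions (d : ℕ)
    (Sp Sm : ℝ → C(Torus d, ℝ) → C(Torus d, ℝ))
    (h : SGSettingCore Sp Sm)
    (φp φm : C(Torus d, ℝ)) (hφp : IsFixedPlus Sp φp) (hφm : IsFixedMinus Sm φm)
    (hle : φm ≤ φp)
    (u : C(Torus d, ℝ)) (hu1 : φm ≤ u) (hu2 : u ≤ φp) :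
    ∀ L : List (Bool × ℝ), (∀ p ∈ L, 0 ≤ p.2) →
      φm ≤ applyOps Sp Sm L u ∧ applyOps Sp Sm L u ≤ φp :=
  fun L hL => ⟨h.le_applyOps hφm hu1 L hL, h.applyOps_le hφp hu2 L hL⟩
end

section
/- In the abstract semigroup setting, let ξ : ℝ → ℝ be continuous with limsup_{t → ±∞} ξ(t) = +∞ and liminf_{t → ±∞} ξ(t) = −∞, let (U(s,t))_{s ≤ t} be an evolution family compatible with (S₊, S₋) and ξ, let (φ⁺, φ⁻) be a conjugate pair, and let ψ : ℝ → X be the unique map with ψ(t) = U(s,t)(ψ(s)) for s ≤ t and φ⁻ ≤ ψ(t) ≤ φ⁺ for all t. Then there exist sequences t_n → +∞ and s_n → +∞ such that ψ(t_n) → φ⁺ and ψ(s_n) → φ⁻ uniformly; consequently, pointwise, limsup_{t → ∞} ψ(t) = φ⁺ and liminf_{t → ∞} ψ(t) = φ⁻. -/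
open Filter Topology

/-- The abstract semigroup setting: two semigroups `S₊ = Sp`, `S₋ = Sm` on an ordered
normed space `X`, each `S_±(t)` order-preserving and nonexpansive, satisfying the order
inequality `S₋(t)(S₊(t)u) ≤ u ≤ S₊(t)(S₋(t)u)`, and such that the uniform limits
`S₊(∞)u = Spinf u` and `S₋(∞)u = Sminf u` exist. -/
structure SGSetting {X : Type*} [NormedAddCommGroup X] [PartialOrder X]
    (Sp Sm : ℝ → X → X) (Spinf Sminf : X → X) : Prop where
  Sp_zero : ∀ u, Sp 0 u = u
  Sm_zero : ∀ u, Sm 0 u = u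
  Sp_add : ∀ s t : ℝ, 0 ≤ s → 0 ≤ t → ∀ u, Sp (s + t) u = Sp s (Sp t u)
  Sm_add : ∀ s t : ℝ, 0 ≤ s → 0 ≤ t → ∀ u, Sm (s + t) u = Sm s (Sm t u)
  Sp_mono : ∀ t : ℝ, 0 ≤ t → ∀ u v, u ≤ v → Sp t u ≤ Sp t v
  Sm_mono : ∀ t : ℝ, 0 ≤ t → ∀ u v, u ≤ v → Sm t u ≤ Sm t v
  Sp_nonexp : ∀ t : ℝ, 0 ≤ t → ∀ u v, ‖Sp t u - Sp t v‖ ≤ ‖u - v‖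
  Sm_nonexp : ∀ t : ℝ, 0 ≤ t → ∀ u v, ‖Sm t u - Sm t v‖ ≤ ‖u - v‖
  order_le : ∀ t : ℝ, 0 ≤ t → ∀ u, Sm t (Sp t u) ≤ u
  order_ge : ∀ t : ℝ, 0 ≤ t → ∀ u, u ≤ Sp t (Sm t u)
  Sp_lim : ∀ u, Tendsto (fun T : ℝ => Sp T u) atTop (nhds (Spinf u))
  Sm_lim : ∀ u, Tendsto (fun T : ℝ => Sm T u) atTop (nhds (Sminf u))

/-- An evolution family `U(s,t)`, `s ≤ t`, compatible with `(S₊, S₋)` and the driving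
path `ξ`: it has the evolution property, each `U(s,t)` is order-preserving and
nonexpansive, and on intervals on which `ξ` attains its minimum at the left endpoint
and its maximum at the right endpoint (resp. vice versa) it is given by
`S₊(ξ t - ξ s)` (resp. `S₋(ξ s - ξ t)`). -/
structure EvolutionFamily {X : Type*} [NormedAddCommGroup X] [PartialOrder X]
    (Sp Sm : ℝ → X → X) (ξ : ℝ → ℝ) (U : ℝ → ℝ → X → X) : Prop where
  idem : ∀ t u, U t t u = u
  comp : ∀ s t r : ℝ, s ≤ t → t ≤ r → ∀ u, U s r u = U t r (U s t u)
  mono : ∀ s t : ℝ, s ≤ t → ∀ u v, u ≤ v → U s t u ≤ U s t v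
  nonexp : ∀ s t : ℝ, s ≤ t → ∀ u v, ‖U s t u - U s t v‖ ≤ ‖u - v‖
  up : ∀ s t : ℝ, s ≤ t → ξ s = sInf (ξ '' Set.Icc s t) →
    ξ t = sSup (ξ '' Set.Icc s t) → ∀ u, U s t u = Sp (ξ t - ξ s) u
  down : ∀ s t : ℝ, s ≤ t → ξ s = sSup (ξ '' Set.Icc s t) →
    ξ t = sInf (ξ '' Set.Icc s t) → ∀ u, U s t u = Sm (ξ s - ξ t) u

/-- A continuous function that is frequently large at `+∞` has, arbitrarily far out, intervals on
which it rises by at least `R` from its minimum at the left endpoint to its maximum at the right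
endpoint. -/
theorem exists_Icc_isLeast_isGreatest_image {f : ℝ → ℝ} (hf : Continuous f)
    (hlarge : ∀ M : ℝ, ∃ᶠ t in atTop, M ≤ f t) (N R : ℝ) :
    ∃ s t : ℝ, N ≤ s ∧ s ≤ t ∧ IsLeast (f '' Set.Icc s t) (f s) ∧
      IsGreatest (f '' Set.Icc s t) (f t) ∧ R ≤ f t - f s := by
  obtain ⟨b, hNb, hb⟩ := (frequently_atTop.1 (hlarge (f N + R))) N
  obtain ⟨t, ht, htmax⟩ :=
    isCompact_Icc.exists_isMaxOn (Set.nonempty_Icc.2 hNb) hf.continuousOn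
  obtain ⟨s, hs, hsmin⟩ :=
    isCompact_Icc.exists_isMinOn (Set.nonempty_Icc.2 ht.1) hf.continuousOn
  have htb : f b ≤ f t := htmax (Set.right_mem_Icc.2 hNb)
  have hsN : f s ≤ f N := hsmin (Set.left_mem_Icc.2 ht.1)
  refine ⟨s, t, hs.1, hs.2, ⟨Set.mem_image_of_mem f (Set.left_mem_Icc.2 hs.2), ?_⟩,
    ⟨Set.mem_image_of_mem f (Set.right_mem_Icc.2 hs.2), ?_⟩, by linarith⟩
  · rintro _ ⟨x, hx, rfl⟩
    exact hsmin ⟨hs.1.trans hx.1, hx.2⟩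
  · rintro _ ⟨x, hx, rfl⟩
    exact htmax ⟨hs.1.trans hx.1, hx.2.trans ht.2⟩

theorem ContinuousMap.norm_le_norm_of_nonneg_of_le {K : Type*} [TopologicalSpace K]
    [CompactSpace K] {u v : C(K, ℝ)} (hu : 0 ≤ u) (huv : u ≤ v) : ‖u‖ ≤ ‖v‖ := by
  refine (ContinuousMap.norm_le _ (norm_nonneg v)).2 fun x => ?_
  have hx : 0 ≤ u x := hu x
  rw [Real.norm_of_nonneg hx]
  exact (huv x).trans ((le_abs_self _).trans (v.norm_coe_le_norm x))

theorem limsup_eq_of_le_of_tendsto_comp {α : Type*} {l : Filter α} {f : α → ℝ} {c : ℝ}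
    (hle : ∀ a, f a ≤ c) {u : ℕ → α} (hu : Tendsto u atTop l)
    (hlim : Tendsto (f ∘ u) atTop (𝓝 c)) : limsup f l = c := by
  have hbdd : IsBoundedUnder (· ≤ ·) l f := isBoundedUnder_of ⟨c, hle⟩
  have hfreq : ∀ b < c, ∃ᶠ a in l, b ≤ f a := fun b hb =>
    hu.frequently ((hlim.eventually_const_le hb).frequently)
  refine le_antisymm (limsup_le_of_le ?_ (Eventually.of_forall hle)) ?_
  · exact IsCobounded.of_frequently_ge (hfreq (c - 1) (by linarith))
  · exact le_of_forall_lt_imp_le_of_dense fun b hb => le_limsup_of_frequently_le (hfreq b hb) hbdd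

theorem liminf_eq_of_ge_of_tendsto_comp {α : Type*} {l : Filter α} {f : α → ℝ} {c : ℝ}
    (hge : ∀ a, c ≤ f a) {u : ℕ → α} (hu : Tendsto u atTop l)
    (hlim : Tendsto (f ∘ u) atTop (𝓝 c)) : liminf f l = c := by
  have hbdd : IsBoundedUnder (· ≥ ·) l f := isBoundedUnder_of ⟨c, hge⟩
  have hfreq : ∀ b > c, ∃ᶠ a in l, f a ≤ b := fun b hb =>
    hu.frequently ((hlim.eventually_le_const hb).frequently)
  refine le_antisymm ?_ (le_liminf_of_le ?_ (Eventually.of_forall hge))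
  · exact le_of_forall_gt_imp_ge_of_dense fun b hb => liminf_le_of_frequently_le (hfreq b hb) hbdd
  · exact IsCobounded.of_frequently_le (hfreq (c + 1) (by linarith))

/-- If a conjugate pair `(φp, Sminf φp)` is ordered, flowing its lower element forward recovers the
upper one. -/
theorem SGSetting.tendsto_Sp_of_conjugate {K : Type*} [TopologicalSpace K] [CompactSpace K]
    {Sp Sm : ℝ → C(K, ℝ) → C(K, ℝ)} {Spinf Sminf : C(K, ℝ) → C(K, ℝ)}
    (h : SGSetting Sp Sm Spinf Sminf) {φp : C(K, ℝ)} (hφp : IsFixedPlus Sp φp)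
    (hle : Sminf φp ≤ φp) : Tendsto (fun T => Sp T (Sminf φp)) atTop (𝓝 φp) := by
  rw [tendsto_iff_norm_sub_tendsto_zero]
  have hlim := tendsto_iff_norm_sub_tendsto_zero.1 (h.Sm_lim φp)
  refine squeeze_zero' (Eventually.of_forall fun _ => norm_nonneg _) ?_ hlim
  filter_upwards [eventually_ge_atTop 0] with T hT
  have hup : Sp T (Sminf φp) ≤ φp := (h.Sp_mono T hT _ _ hle).trans_eq (hφp T hT)
  calc ‖Sp T (Sminf φp) - φp‖ = ‖φp - Sp T (Sminf φp)‖ := norm_sub_rev _ _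
    _ ≤ ‖Sp T (Sm T φp) - Sp T (Sminf φp)‖ :=
      ContinuousMap.norm_le_norm_of_nonneg_of_le (sub_nonneg.2 hup)
        (sub_le_sub_right (h.order_ge T hT φp) _)
    _ ≤ ‖Sm T φp - Sminf φp‖ := h.Sp_nonexp T hT _ _

/-- In the abstract semigroup setting on `X = C(𝕋^d; ℝ)`, with `ξ`
continuous and oscillating unboundedly at both `±∞`, and `ψ` the global solution
associated to a conjugate pair `(φ⁺, φ⁻)`: there exist sequences `t_n → +∞` and
`s_n → +∞` such that `ψ(t_n) → φ⁺` and `ψ(s_n) → φ⁻` uniformly; consequently,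
pointwise, `limsup_{t→∞} ψ t = φ⁺` and `liminf_{t→∞} ψ t = φ⁻`. -/
theorem global_solution_forward_behavior (d : ℕ)
    (Sp Sm : ℝ → C(Torus d, ℝ) → C(Torus d, ℝ))
    (Spinf Sminf : C(Torus d, ℝ) → C(Torus d, ℝ))
    (h : SGSetting Sp Sm Spinf Sminf)
    (ξ : ℝ → ℝ) (hξc : Continuous ξ)
    (hξ1 : ∀ M : ℝ, ∃ᶠ t in atBot, M ≤ ξ t) (hξ2 : ∀ M : ℝ, ∃ᶠ t in atBot, ξ t ≤ -M)
    (hξ3 : ∀ M : ℝ, ∃ᶠ t in atTop, M ≤ ξ t) (hξ4 : ∀ M : ℝ, ∃ᶠ t in atTop, ξ t ≤ -M)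
    (U : ℝ → ℝ → C(Torus d, ℝ) → C(Torus d, ℝ))
    (hU : EvolutionFamily Sp Sm ξ U)
    (φp φm : C(Torus d, ℝ)) (hφp : IsFixedPlus Sp φp) (hφm : IsFixedMinus Sm φm)
    (hconj : φm = Sminf φp)
    (ψ : ℝ → C(Torus d, ℝ))
    (hψflow : ∀ s t : ℝ, s ≤ t → ψ t = U s t (ψ s))
    (hψbnd : ∀ t : ℝ, φm ≤ ψ t ∧ ψ t ≤ φp) :
    (∃ tseq : ℕ → ℝ, Tendsto tseq atTop atTop ∧
        Tendsto (fun n => ψ (tseq n)) atTop (nhds φp)) ∧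
    (∃ sseq : ℕ → ℝ, Tendsto sseq atTop atTop ∧
        Tendsto (fun n => ψ (sseq n)) atTop (nhds φm)) ∧
    (∀ x : Torus d, Filter.limsup (fun t : ℝ => ψ t x) atTop = φp x) ∧
    (∀ x : Torus d, Filter.liminf (fun t : ℝ => ψ t x) atTop = φm x) := by
  subst hconj
  have hSp := h.tendsto_Sp_of_conjugate hφp ((hψbnd 0).1.trans (hψbnd 0).2)
  have hup : ∀ n : ℕ, ∃ t r : ℝ, (n : ℝ) ≤ t ∧ (n : ℝ) ≤ r ∧ Sp r (Sminf φp) ≤ ψ t := by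
    intro n
    obtain ⟨s, t, hns, hst, hmin, hmax, hr⟩ := exists_Icc_isLeast_isGreatest_image hξc hξ3 n n
    refine ⟨t, ξ t - ξ s, hns.trans hst, hr, ?_⟩
    rw [hψflow s t hst, hU.up s t hst hmin.csInf_eq.symm hmax.csSup_eq.symm]
    exact h.Sp_mono _ (n.cast_nonneg.trans hr) _ _ (hψbnd s).1
  have hdown : ∀ n : ℕ, ∃ t r : ℝ, (n : ℝ) ≤ t ∧ (n : ℝ) ≤ r ∧ ψ t ≤ Sm r φp := by
    intro n
    obtain ⟨s, t, hns, hst, hmin, hmax, hr⟩ := exists_Icc_isLeast_isGreatest_image hξc.neg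
      (fun M => (hξ4 M).mono fun t ht => le_neg_of_le_neg ht) n n
    have hsup : IsGreatest (ξ '' Set.Icc s t) (ξ s) :=
      ⟨Set.mem_image_of_mem ξ (Set.left_mem_Icc.2 hst), by
        rintro _ ⟨x, hx, rfl⟩
        exact neg_le_neg_iff.1 (hmin.2 (Set.mem_image_of_mem _ hx))⟩
    have hinf : IsLeast (ξ '' Set.Icc s t) (ξ t) :=
      ⟨Set.mem_image_of_mem ξ (Set.right_mem_Icc.2 hst), by
        rintro _ ⟨x, hx, rfl⟩
        exact neg_le_neg_iff.1 (hmax.2 (Set.mem_image_of_mem _ hx))⟩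
    have hr' : (n : ℝ) ≤ ξ s - ξ t := by
      simp only [Pi.neg_apply] at hr
      linarith
    refine ⟨t, ξ s - ξ t, hns.trans hst, hr', ?_⟩
    rw [hψflow s t hst, hU.down s t hst hsup.csSup_eq.symm hinf.csInf_eq.symm]
    exact h.Sm_mono _ (n.cast_nonneg.trans hr') _ _ (hψbnd s).2
  choose tseq r ht hr hψt using hup
  choose sseq q hs hq hψs using hdown
  have htop {a : ℕ → ℝ} (ha : ∀ n : ℕ, (n : ℝ) ≤ a n) : Tendsto a atTop atTop :=
    tendsto_atTop_mono ha tendsto_natCast_atTop_atTop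
  have hψp : Tendsto (fun n => ψ (tseq n)) atTop (𝓝 φp) := by
    rw [tendsto_iff_norm_sub_tendsto_zero]
    refine squeeze_zero (fun _ => norm_nonneg _) (fun n => ?_)
      (tendsto_iff_norm_sub_tendsto_zero.1 (hSp.comp (htop hr)))
    rw [norm_sub_rev, norm_sub_rev _ φp]
    exact ContinuousMap.norm_le_norm_of_nonneg_of_le (sub_nonneg.2 (hψbnd _).2)
      (sub_le_sub_left (hψt n) _)
  have hψm : Tendsto (fun n => ψ (sseq n)) atTop (𝓝 (Sminf φp)) := by
    rw [tendsto_iff_norm_sub_tendsto_zero]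
    refine squeeze_zero (fun _ => norm_nonneg _) (fun n => ?_)
      (tendsto_iff_norm_sub_tendsto_zero.1 ((h.Sm_lim φp).comp (htop hq)))
    exact ContinuousMap.norm_le_norm_of_nonneg_of_le (sub_nonneg.2 (hψbnd _).1)
      (sub_le_sub_right (hψs n) _)
  refine ⟨⟨tseq, htop ht, hψp⟩, ⟨sseq, htop hs, hψm⟩, fun x => ?_, fun x => ?_⟩
  · exact limsup_eq_of_le_of_tendsto_comp (fun t => (hψbnd t).2 x) (htop ht)
      (((continuous_eval_const x).tendsto φp).comp hψp)
  · exact liminf_eq_of_ge_of_tendsto_comp (fun t => (hψbnd t).1 x) (htop hs)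
      (((continuous_eval_const x).tendsto _).comp hψm)
end
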